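/- Let q ∈ ℕ, β ∈ (0,2), and let f : [1,∞) → [1,∞) satisfy k^{2q−1} f(k)^{−2q} + k f(k)^{−β} → 0 as k → ∞. Then there exist C > 0 and k₀ ≥ 1 such that for every integer k ≥ k₀ and every real ρ with 0 < ρ ≤ k − f(k), one has | ∫₀^1 e^{ρ t} (1−t)^{k−q} (1 + ρ t/(k−ρ))^{2q} dt − 1/(k−ρ) | ≤ C k / (k−ρ)^{β+1}. -/

import Mathlib

open MeasureTheory

/-- A convexity bound: `(1 + x)ⁿ - 1 ≤ n x (1 + x)ⁿ` for `x ≥ 0`. -/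
theorem one_add_pow_sub_one_le {x : ℝ} (hx : 0 ≤ x) (n : ℕ) :
    (1 + x) ^ n - 1 ≤ n * x * (1 + x) ^ n := by
  induction n with
  | zero => simp
  | succ n ih =>
    have hp : 0 ≤ (1 + x) ^ n := by positivity
    have h : 0 ≤ (n + 1) * x * x * (1 + x) ^ n := by positivity
    rw [pow_succ]
    push_cast
    nlinarith

/-- Polynomial growth is dominated by exponential growth. -/
theorem one_add_pow_le_mul_exp_half (n : ℕ) {y : ℝ} (hy : 0 ≤ y) :
    (1 + y) ^ n ≤ (2 ^ n * n.factorial * Real.exp (1 / 2)) * Real.exp (y / 2) := by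
  have h := Real.pow_div_factorial_le_exp ((1 + y) / 2) (by positivity) n
  have hn : (0 : ℝ) < n.factorial := by positivity
  rw [div_le_iff₀ hn, div_pow, div_le_iff₀ (by positivity), add_div, Real.exp_add] at h
  linarith

theorem integral_exp_neg_mul_zero_one {a : ℝ} (ha : a ≠ 0) :
    ∫ t in (0:ℝ)..1, Real.exp (-(a * t)) = 1 / a - Real.exp (-a) / a := by
  have hd : ∀ t ∈ Set.uIcc (0:ℝ) 1,
      HasDerivAt (fun t => -(Real.exp (-(a * t)) / a)) (Real.exp (-(a * t))) t := by
    intro t _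
    have h1 : HasDerivAt (fun t : ℝ => -(a * t)) (-(a * 1)) t :=
      ((hasDerivAt_id t).const_mul a).neg
    refine (h1.exp.div_const a).neg.congr_deriv ?_
    field_simp
  rw [intervalIntegral.integral_eq_sub_of_hasDerivAt hd
    (Continuous.intervalIntegrable (by fun_prop) _ _)]
  simp
  ring

theorem integral_mul_exp_neg_mul_zero_one_le {a : ℝ} (ha : 0 < a) :
    ∫ t in (0:ℝ)..1, t * Real.exp (-(a * t)) ≤ 1 / a ^ 2 := by
  have hd : ∀ t ∈ Set.uIcc (0:ℝ) 1,
      HasDerivAt (fun t => -((t / a + 1 / a ^ 2) * Real.exp (-(a * t))))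
        (t * Real.exp (-(a * t))) t := by
    intro t _
    have h1 : HasDerivAt (fun t : ℝ => -(a * t)) (-(a * 1)) t :=
      ((hasDerivAt_id t).const_mul a).neg
    have h2 : HasDerivAt (fun t : ℝ => t / a + 1 / a ^ 2) (1 / a) t :=
      ((hasDerivAt_id t).div_const a).add_const _
    refine (h2.mul h1.exp).neg.congr_deriv ?_
    field_simp
    ring
  rw [intervalIntegral.integral_eq_sub_of_hasDerivAt hd
    (Continuous.intervalIntegrable (by fun_prop) _ _)]
  have : 0 ≤ (1 / a + 1 / a ^ 2) * Real.exp (-(a * 1)) := by positivity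
  simp only [zero_div, mul_zero, neg_zero, Real.exp_zero, mul_one, zero_add] at this ⊢
  linarith

theorem exp_mul_one_sub_pow_le {k q : ℕ} {ρ t : ℝ} (ht0 : 0 ≤ t) (ht1 : t ≤ 1) :
    Real.exp (ρ * t) * (1 - t) ^ (k - q) ≤ Real.exp (q * t) * Real.exp (-((k - ρ) * t)) := by
  have hkq : (k : ℝ) - q ≤ ((k - q : ℕ) : ℝ) := by
    rw [sub_le_iff_le_add]
    exact_mod_cast (by omega : k ≤ k - q + q)
  have h : (1 - t) ^ (k - q) ≤ Real.exp (((k - q : ℕ) : ℝ) * -t) := by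
    rw [Real.exp_nat_mul]
    exact pow_le_pow_left₀ (by linarith) (Real.one_sub_le_exp_neg t) _
  calc Real.exp (ρ * t) * (1 - t) ^ (k - q)
      ≤ Real.exp (ρ * t) * Real.exp (((k - q : ℕ) : ℝ) * -t) := by gcongr
    _ ≤ _ := by
      rw [← Real.exp_add, ← Real.exp_add, Real.exp_le_exp]
      nlinarith

theorem one_sub_mul_sq_mul_exp_le {k q : ℕ} {ρ t : ℝ} (ht0 : 0 ≤ t) (ht1 : t ≤ 1) :
    (1 - k * t ^ 2) * Real.exp (-((k - ρ) * t)) ≤ Real.exp (ρ * t) * (1 - t) ^ (k - q) := by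
  have hB : 1 - k * t ^ 2 ≤ (1 - t ^ 2) ^ k := by
    have := one_add_mul_le_pow (a := -t ^ 2) (by nlinarith) k
    rwa [mul_neg, ← sub_eq_add_neg, ← sub_eq_add_neg] at this
  have hP : (1 - t ^ 2) ^ k ≤ Real.exp (k * t) * (1 - t) ^ k := by
    rw [Real.exp_nat_mul, ← mul_pow]
    refine pow_le_pow_left₀ (by nlinarith) ?_ k
    nlinarith [Real.add_one_le_exp t]
  have hE : Real.exp (ρ * t) = Real.exp (k * t) * Real.exp (-((k - ρ) * t)) := by
    rw [← Real.exp_add]; ring_nf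
  have hQ : (1 - t) ^ k ≤ (1 - t) ^ (k - q) :=
    pow_le_pow_of_le_one (by linarith) (by linarith) (Nat.sub_le k q)
  calc (1 - k * t ^ 2) * Real.exp (-((k - ρ) * t))
      ≤ (Real.exp (k * t) * (1 - t) ^ k) * Real.exp (-((k - ρ) * t)) := by
        gcongr; exact hB.trans hP
    _ = Real.exp (ρ * t) * (1 - t) ^ k := by rw [hE]; ring
    _ ≤ _ := by gcongr

/-- The integrand differs from `exp (-(k - ρ) t)` by at most a constant times
`k / (k - ρ) * t * exp (-(k - ρ) t / 2)`. -/
theorem abs_integrand_sub_exp_le {k q : ℕ} {ρ t : ℝ} (ht0 : 0 ≤ t) (ht1 : t ≤ 1) (hρ : 0 < ρ)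
    (hD : 0 < k - ρ) (hkD : (k : ℝ) ≤ (k - ρ) ^ 2) :
    |Real.exp (ρ * t) * (1 - t) ^ (k - q) * (1 + ρ * t / (k - ρ)) ^ (2 * q)
        - Real.exp (-((k - ρ) * t))| ≤
      (3 * q * Real.exp q * (2 ^ (2 * q) * (2 * q).factorial * Real.exp (1 / 2)) + 2) *
        (k / (k - ρ)) * (t * Real.exp (-((k - ρ) / 2 * t))) := by
  set D : ℝ := k - ρ with hDdef
  set K : ℝ := 2 ^ (2 * q) * (2 * q).factorial * Real.exp (1 / 2) with hK
  set x : ℝ := ρ * t / D with hxdef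
  set r : ℝ := k / D with hr
  set F : ℝ := Real.exp (-(D / 2 * t)) with hF
  have hK0 : 0 ≤ K := by positivity
  have hx0 : 0 ≤ x := by positivity
  have hr1 : 1 ≤ r := by rw [hr, le_div_iff₀ hD]; linarith
  have hxr : x ≤ r * t := by
    rw [hxdef, hr, div_mul_eq_mul_div]
    gcongr; linarith
  have hxD : x ≤ D * t := by
    refine hxr.trans ?_
    gcongr
    rw [hr, div_le_iff₀ hD]; nlinarith
  have hF0 : 0 < F := Real.exp_pos _
  have hFF : Real.exp (-(D * t)) = F * F := by rw [hF, ← Real.exp_add]; ring_nf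
  have hFh : Real.exp (D * t / 2) * F = 1 := by
    rw [hF, ← Real.exp_add, ← Real.exp_zero]; ring_nf
  have hB1 : 1 ≤ (1 + x) ^ (2 * q) := one_le_pow₀ (by linarith)
  have hBF : (1 + x) ^ (2 * q) * F ≤ K := by
    calc (1 + x) ^ (2 * q) * F ≤ (1 + D * t) ^ (2 * q) * F := by gcongr
      _ ≤ K * Real.exp (D * t / 2) * F := by
        gcongr; exact one_add_pow_le_mul_exp_half _ (by positivity)
      _ = K := by rw [mul_assoc, hFh, mul_one]
  rw [hFF]
  have hU := exp_mul_one_sub_pow_le (k := k) (q := q) (ρ := ρ) ht0 ht1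
  have hL := one_sub_mul_sq_mul_exp_le (k := k) (q := q) (ρ := ρ) ht0 ht1
  rw [← hDdef, hFF] at hU hL
  set G : ℝ := Real.exp (ρ * t) * (1 - t) ^ (k - q) with hG
  have hG0 : 0 ≤ G := mul_nonneg (Real.exp_pos _).le (pow_nonneg (by linarith) _)
  set B : ℝ := (1 + x) ^ (2 * q) with hB
  have hrt : t ≤ r * t := le_mul_of_one_le_left ht0 hr1
  have hextra : 0 ≤ 3 * q * Real.exp q * K * r * (t * F) := by positivity
  rw [abs_le]
  constructor
  · have hDF : D * t * F ≤ 2 := by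
      have : D * t / 2 ≤ Real.exp (D * t / 2) := by linarith [Real.add_one_le_exp (D * t / 2)]
      nlinarith
    have hkt : k * t ^ 2 * (F * F) ≤ 2 * r * (t * F) := by
      have : k * t ^ 2 * (F * F) = r * (t * F) * (D * t * F) := by
        rw [hr]; field_simp
      rw [this]
      have : 0 ≤ r * (t * F) := by positivity
      nlinarith
    have hGB : G ≤ G * B := le_mul_of_one_le_right hG0 hB1
    linarith
  · have hA : Real.exp (q * t) - 1 ≤ q * t * Real.exp q := by
      have h1 : Real.exp (q * t) - 1 ≤ q * t * Real.exp (q * t) := by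
        have h := Real.one_sub_le_exp_neg (q * t)
        have h2 : Real.exp (-(q * t)) * Real.exp (q * t) = 1 := by
          rw [← Real.exp_add]; simp
        nlinarith [Real.exp_pos (q * t)]
      refine h1.trans ?_
      gcongr
      exact mul_le_of_le_one_right (by positivity) ht1
    have hB2 : B - 1 ≤ 2 * q * x * B := by
      have := one_add_pow_sub_one_le hx0 (2 * q)
      push_cast at this
      exact this
    have hE1 : 1 ≤ Real.exp q := Real.one_le_exp (by positivity)
    have hw : Real.exp (q * t) * B - 1 ≤ 3 * q * Real.exp q * (r * t) * B := by
      have e1 : (Real.exp (q * t) - 1) * B ≤ q * (r * t) * Real.exp q * B := by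
        gcongr
        exact hA.trans (by gcongr)
      have e2 : 2 * q * x * B ≤ 2 * q * (r * t) * Real.exp q * B := by
        have : 2 * q * x ≤ 2 * q * (r * t) * Real.exp q :=
          le_trans (by gcongr) (le_mul_of_one_le_right (by positivity) hE1)
        gcongr
      linarith
    have h0 : 0 ≤ 2 * r * (t * F) := by positivity
    calc G * B - F * F ≤ Real.exp (q * t) * (F * F) * B - F * F := by gcongr
      _ = (Real.exp (q * t) * B - 1) * (F * F) := by ring
      _ ≤ 3 * q * Real.exp q * (r * t) * B * (F * F) := by gcongr
      _ = 3 * q * Real.exp q * (r * t) * F * (B * F) := by ring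
      _ ≤ 3 * q * Real.exp q * (r * t) * F * K := by gcongr
      _ ≤ _ := by linarith

theorem exists_abs_integral_sub_le (q : ℕ) :
    ∃ C > 0, ∀ (k : ℕ) (ρ : ℝ), 0 < ρ → 0 < k - ρ → (k : ℝ) ≤ (k - ρ) ^ 2 →
      |(∫ t in (0:ℝ)..1, Real.exp (ρ * t) * (1 - t) ^ (k - q) *
          (1 + ρ * t / ((k : ℝ) - ρ)) ^ (2 * q)) - 1 / ((k : ℝ) - ρ)| ≤
        C * k / ((k : ℝ) - ρ) ^ 3 := by
  set M : ℝ := 3 * q * Real.exp q * (2 ^ (2 * q) * (2 * q).factorial * Real.exp (1 / 2)) + 2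
    with hM
  have hM0 : 0 < M := by positivity
  refine ⟨4 * M + 1, by positivity, fun k ρ hρ hD hkD => ?_⟩
  set g : ℝ → ℝ := fun t => Real.exp (ρ * t) * (1 - t) ^ (k - q) *
    (1 + ρ * t / ((k : ℝ) - ρ)) ^ (2 * q) with hg
  have hbound := fun t (ht : t ∈ Set.Ioc (0:ℝ) 1) =>
    abs_integrand_sub_exp_le (k := k) (q := q) ht.1.le ht.2 hρ hD hkD
  rw [← hM] at hbound
  set D : ℝ := k - ρ with hDdef
  have hgc : Continuous g := by fun_prop
  have hmain : |∫ t in (0:ℝ)..1, (g t - Real.exp (-(D * t)))| ≤ 4 * M * k / D ^ 3 := by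
    have h := intervalIntegral.norm_integral_le_of_norm_le (μ := volume)
      (f := fun t => g t - Real.exp (-(D * t)))
      (g := fun t => M * (k / D) * (t * Real.exp (-(D / 2 * t)))) zero_le_one
      (Filter.Eventually.of_forall hbound)
      (Continuous.intervalIntegrable (by fun_prop) _ _)
    rw [Real.norm_eq_abs, intervalIntegral.integral_const_mul] at h
    refine h.trans ?_
    calc M * (k / D) * ∫ t in (0:ℝ)..1, t * Real.exp (-(D / 2 * t))
        ≤ M * (k / D) * (1 / (D / 2) ^ 2) := by
          gcongr; exact integral_mul_exp_neg_mul_zero_one_le (by positivity)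
      _ = 4 * M * k / D ^ 3 := by field_simp; ring
  rw [intervalIntegral.integral_sub (hgc.intervalIntegrable _ _)
    (Continuous.intervalIntegrable (by fun_prop) _ _),
    integral_exp_neg_mul_zero_one hD.ne'] at hmain
  have hexp : Real.exp (-D) / D ≤ k / D ^ 3 := by
    have h1 : D * Real.exp (-D) ≤ 1 := by
      have : Real.exp D * Real.exp (-D) = 1 := by rw [← Real.exp_add]; simp
      nlinarith [Real.add_one_le_exp D, Real.exp_pos (-D)]
    rw [div_le_div_iff₀ hD (by positivity)]
    have : Real.exp (-D) * D ^ 3 = (D * Real.exp (-D)) * (D * D) := by ring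
    rw [this]
    have hDk : D ≤ k := by linarith
    calc (D * Real.exp (-D)) * (D * D) ≤ 1 * (k * D) := by gcongr
      _ = k * D := one_mul _
  have hpos : 0 ≤ Real.exp (-D) / D := by positivity
  have hsplit : (4 * M + 1) * k / D ^ 3 = 4 * M * k / D ^ 3 + k / D ^ 3 := by ring
  rw [hsplit]
  rw [abs_le] at hmain ⊢
  constructor <;> linarith [hmain.1, hmain.2]

/-- for q ∈ ℕ, β ∈ (0,2) and f : [1,∞) → [1,∞) with
k^{2q−1} f(k)^{−2q} + k f(k)^{−β} → 0, there are C > 0 and k₀ ≥ 1 such that for integers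
k ≥ k₀ and 0 < ρ ≤ k − f(k),
|∫₀¹ e^{ρt}(1−t)^{k−q}(1+ρt/(k−ρ))^{2q} dt − 1/(k−ρ)| ≤ C k/(k−ρ)^{β+1}. -/
theorem statement8 (q : ℕ) (β : ℝ) (hβ : β ∈ Set.Ioo (0:ℝ) 2) (f : ℝ → ℝ)
    (hf_dom : ∀ x : ℝ, 1 ≤ x → 1 ≤ f x)
    (hf_lim : Filter.Tendsto
      (fun x : ℝ => x ^ (2 * (q : ℝ) - 1) * (f x) ^ (-(2 * (q : ℝ))) + x * (f x) ^ (-β))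
      Filter.atTop (nhds 0)) :
    ∃ C > 0, ∃ k₀ : ℕ, 1 ≤ k₀ ∧ ∀ k : ℕ, k₀ ≤ k → ∀ ρ : ℝ, 0 < ρ → ρ ≤ (k : ℝ) - f k →
      |(∫ t in (0:ℝ)..1, Real.exp (ρ * t) * (1 - t) ^ (k - q) *
          (1 + ρ * t / ((k : ℝ) - ρ)) ^ (2 * q)) - 1 / ((k : ℝ) - ρ)| ≤
        C * k / ((k : ℝ) - ρ) ^ (β + 1) := by
  obtain ⟨C, hC, hint⟩ := exists_abs_integral_sub_le q
  have hev := (hf_lim.comp tendsto_natCast_atTop_atTop).eventually_le_const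
    (zero_lt_one : (0:ℝ) < 1)
  obtain ⟨N, hN⟩ := Filter.eventually_atTop.1 hev
  refine ⟨C, hC, max N 1, le_max_right _ _, fun k hk ρ hρ hρf => ?_⟩
  have hk1 : (1 : ℝ) ≤ k := by exact_mod_cast (le_max_right N 1).trans hk
  have hf1 := hf_dom k hk1
  have hf0 : 0 < f k := by linarith
  have hfD : f k ≤ k - ρ := by linarith
  have hD1 : 1 ≤ (k : ℝ) - ρ := by linarith
  have hkf : (k : ℝ) * f k ^ (-β) ≤ 1 := by
    have h : (k : ℝ) ^ (2 * (q : ℝ) - 1) * f k ^ (-(2 * (q : ℝ))) + k * f k ^ (-β) ≤ 1 :=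
      hN k ((le_max_left N 1).trans hk)
    have : 0 ≤ (k : ℝ) ^ (2 * (q : ℝ) - 1) * f k ^ (-(2 * (q : ℝ))) := by positivity
    linarith
  have hkD : (k : ℝ) ≤ (k - ρ) ^ 2 := by
    rw [Real.rpow_neg hf0.le, ← div_eq_mul_inv, div_le_one (by positivity)] at hkf
    calc (k : ℝ) ≤ f k ^ β := hkf
      _ ≤ f k ^ (2 : ℝ) := Real.rpow_le_rpow_of_exponent_le hf1 hβ.2.le
      _ = f k ^ 2 := Real.rpow_two _
      _ ≤ (k - ρ) ^ 2 := by gcongr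
  refine (hint k ρ hρ (by linarith) hkD).trans ?_
  have hpow : ((k : ℝ) - ρ) ^ (β + 1) ≤ (k - ρ) ^ 3 := by
    rw [← Real.rpow_natCast]
    exact Real.rpow_le_rpow_of_exponent_le hD1 (by push_cast; linarith [hβ.2])
  have : 0 < ((k : ℝ) - ρ) ^ (β + 1) := Real.rpow_pos_of_pos (by linarith) _
  gcongr
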